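/- arXiv:1403.1863 — 2 statements merged into one kernel-verified Lean document; each statement's English description precedes it below -/
import Mathlib

section
/- Let J = Bᵀ B and assume b(i,j) > 0 for every edge {i,j} of G. Then for every pair of vertices i, j with hop distance d(i,j) = 2, the entry J(i,j) is strictly positive; in particular it is nonzero. (The second-neighbor relationship does exist in the J-matrix, as opposed to the claim in prior work.) -/
open Finset Matrix

/-- Two vertices at extended distance `2` are distinct, non-adjacent, and have a common neighbor. -/
theorem SimpleGraph.ne_not_adj_exists_adj_of_edist_eq_two {V : Type*} {G : SimpleGraph V} {u v : V}
    (h : G.edist u v = 2) : u ≠ v ∧ ¬ G.Adj u v ∧ ∃ w, G.Adj w u ∧ G.Adj w v := by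
  refine ⟨?_, ?_, ?_⟩
  · rintro rfl
    simp at h
  · intro hadj
    rw [SimpleGraph.edist_eq_one_iff_adj.mpr hadj] at h
    norm_num at h
  · obtain ⟨q, hq⟩ := G.exists_walk_of_edist_ne_top (h ▸ ENat.ofNat_ne_top 2)
    rw [h] at hq
    have hlen : q.length = 2 := by exact_mod_cast hq
    refine ⟨q.getVert 1, ?_, ?_⟩
    · simpa using (q.adj_getVert_succ (i := 0) (by omega)).symm
    · have hadj := q.adj_getVert_succ (i := 1) (by omega)
      rwa [show 1 + 1 = q.length by omega, q.getVert_length] at hadj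

/-- The second-neighbor relationship *does* exist in the information matrix:
if `b` is symmetric, vanishes off the edges of `G` and is strictly positive on the
edges of `G`, `B` is the DC power-flow matrix and `J = Bᵀ B`, then for every pair
of vertices at hop distance exactly `2` the entry `J i j` is strictly positive
(in particular nonzero). -/
theorem information_matrix_positive_at_two_hops
    {p : ℕ} (G : SimpleGraph (Fin p))
    (b : Fin p → Fin p → ℝ)
    (hb_symm : ∀ i j, b i j = b j i)
    (hb_zero : ∀ i j, i ≠ j → ¬ G.Adj i j → b i j = 0)
    (hb_pos : ∀ i j, G.Adj i j → 0 < b i j)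
    (B : Matrix (Fin p) (Fin p) ℝ)
    (hB : ∀ i j, B i j = if i = j then ∑ k ∈ univ \ {i}, b i k else - b i j)
    (J : Matrix (Fin p) (Fin p) ℝ) (hJ : J = Bᵀ * B)
    (i j : Fin p) (hdist : G.edist i j = 2) :
    0 < J i j ∧ J i j ≠ 0 := by
  obtain ⟨hij, hnadj, w, hwi, hwj⟩ := SimpleGraph.ne_not_adj_exists_adj_of_edist_eq_two hdist
  have b_nonneg : ∀ k l, k ≠ l → 0 ≤ b k l := fun k l hkl => by
    by_cases hadj : G.Adj k l
    · exact (hb_pos k l hadj).le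
    · exact (hb_zero k l hkl hadj).ge
  have b_ij : b i j = 0 := hb_zero i j hij hnadj
  have b_ji : b j i = 0 := hb_symm i j ▸ b_ij
  have J_pos : 0 < J i j := by
    rw [hJ, Matrix.mul_apply]
    refine Finset.sum_pos' (fun k _ => ?_) ⟨w, Finset.mem_univ w, ?_⟩
    · rw [Matrix.transpose_apply]
      rcases eq_or_ne k i with rfl | hki
      · simp [hB k j, hij, b_ij]
      rcases eq_or_ne k j with rfl | hkj
      · simp [hB k i, hki, b_ji]
      rw [hB k i, hB k j, if_neg hki, if_neg hkj, neg_mul_neg]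
      exact mul_nonneg (b_nonneg k i hki) (b_nonneg k j hkj)
    · rw [Matrix.transpose_apply, hB w i, hB w j, if_neg hwi.ne, if_neg hwj.ne, neg_mul_neg]
      exact mul_pos (hb_pos w i hwi) (hb_pos w j hwj)
  exact ⟨J_pos, J_pos.ne'⟩
end

section
/- Let H be a real m × p matrix with full column rank (so Hᵀ H is invertible), and define the weighted-least-squares state estimate of a measurement vector z ∈ ℝ^m by x̂(z) = (Hᵀ H)⁻¹ Hᵀ z. Let the attack vector be a = H d for some d ∈ ℝ^p (i.e. a ∈ Im(H)), and set z^a = z + a. Then x̂(z^a) = x̂(z) + d, and the measurement residual is unchanged: z^a − H x̂(z^a) = z − H x̂(z). (Hence an attack in the image of H is undetectable by residual-based bad data detection, which is the defining property of the stealthy deception attack.) -/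
open Matrix

/-- **Stealthy deception attack is residual-invisible.** Let `H` be a real `m × p`
matrix with full column rank (so `Hᵀ H` is invertible), and let
`x̂(z) = (Hᵀ H)⁻¹ Hᵀ z` be the least-squares state estimate of a measurement `z`.
If the attack vector is `a = H d` (so `a ∈ Im H`) and `z^a = z + a`, then
`x̂(z^a) = x̂(z) + d` and the residual is unchanged:
`z^a − H x̂(z^a) = z − H x̂(z)`. -/
theorem stealthy_attack_shifts_estimate_and_preserves_residual
    {m p : ℕ} (H : Matrix (Fin m) (Fin p) ℝ) (hrank : H.rank = p)
    (est : (Fin m → ℝ) → (Fin p → ℝ))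
    (hest : ∀ z, est z = (Hᵀ * H)⁻¹.mulVec (Hᵀ.mulVec z))
    (z a za : Fin m → ℝ) (d : Fin p → ℝ)
    (hattack : a = H.mulVec d) (hza : za = z + a) :
    est za = est z + d ∧
    za - H.mulVec (est za) = z - H.mulVec (est z) := by
  have hdet : IsUnit (Hᵀ * H).det := by
    rw [← Matrix.isUnit_iff_isUnit_det, ← Matrix.linearIndependent_cols_iff_isUnit,
      linearIndependent_iff_card_eq_finrank_span, Set.finrank, ← Matrix.rank_eq_finrank_span_cols,
      Matrix.rank_transpose_mul_self, hrank, Fintype.card_fin]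
  have hest_za : est za = est z + d := by
    rw [hest, hest, hza, hattack, mulVec_add, mulVec_add, mulVec_mulVec d, mulVec_mulVec d,
      nonsing_inv_mul _ hdet, one_mulVec]
  refine ⟨hest_za, ?_⟩
  rw [hest_za, mulVec_add, hza, hattack, add_sub_add_right_eq_sub]
end
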